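/- The set K \ D, with the subspace topology induced from the product topology on ℤ → ℝ, is homeomorphic to the unit circle {p ∈ ℝ² : ‖p‖ = 1}. -/

import Mathlib

/-- The set of functions `f : ℤ → ℝ` of the form `f k = w + v * |x - k|` with
`v, w ≥ 0`, normalized by `f 0 + f 1 = 1`. -/
def K : Set (ℤ → ℝ) :=
  {f | (∃ x v w : ℝ, 0 ≤ v ∧ 0 ≤ w ∧ ∀ k : ℤ, f k = w + v * |x - (k : ℝ)|) ∧ f 0 + f 1 = 1}

/-- The subset of `K` of functions admitting a representation with `v, w > 0`. -/
def D : Set (ℤ → ℝ) :=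
  {f | (∃ x v w : ℝ, 0 < v ∧ 0 < w ∧ ∀ k : ℤ, f k = w + v * |x - (k : ℝ)|) ∧ f 0 + f 1 = 1}

open Filter Topology

/-- A function `k ↦ w + v * |x - k|` on the integers with `v ≠ 0` determines `x`, `v` and `w`. -/
lemma add_mul_abs_sub_intCast_unique {x v w x' v' w' : ℝ} (hv : v ≠ 0)
    (h : ∀ k : ℤ, w + v * |x - (k : ℝ)| = w' + v' * |x' - (k : ℝ)|) :
    x = x' ∧ v = v' ∧ w = w' := by
  obtain ⟨n, hn⟩ : ∃ n : ℤ, |x| + |x'| ≤ n := ⟨_, Int.le_ceil _⟩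
  have hx := abs_le.1 (le_refl |x|)
  have hx' := abs_le.1 (le_refl |x'|)
  have hx0 := abs_nonneg x
  have hx0' := abs_nonneg x'
  have h₁ := h n
  have h₂ := h (n + 1)
  have h₃ := h (-n)
  push_cast at h₁ h₂ h₃
  rw [abs_of_nonpos (by linarith), abs_of_nonpos (by linarith)] at h₁ h₂
  rw [abs_of_nonneg (by linarith), abs_of_nonneg (by linarith)] at h₃
  have hvv : v = v' := by linarith
  subst hvv
  have hxx : x = x' := mul_left_cancel₀ hv (by linarith)
  subst hxx
  exact ⟨rfl, rfl, by linarith⟩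

lemma abs_add_abs_sub_one_pos (x : ℝ) : 0 < |x| + |x - 1| := by
  have := abs_sub_abs_le_abs_sub 1 x
  rw [abs_one, abs_sub_comm] at this
  linarith

/-- The functions `k ↦ |x - k| / (|x| + |x - 1|)`, completed at infinity by their limit, the
constant function `1 / 2`. -/
noncomputable def normalizedAbs (p : OnePoint ℝ) (k : ℤ) : ℝ :=
  p.elim (1 / 2) fun x => |x - (k : ℝ)| / (|x| + |x - 1|)

@[simp] lemma normalizedAbs_infty (k : ℤ) : normalizedAbs OnePoint.infty k = 1 / 2 := rfl

@[simp] lemma normalizedAbs_coe (x : ℝ) (k : ℤ) :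
    normalizedAbs (x : OnePoint ℝ) k = |x - (k : ℝ)| / (|x| + |x - 1|) := rfl

lemma normalizedAbs_coe_eq (x : ℝ) (k : ℤ) :
    normalizedAbs (x : OnePoint ℝ) k = 0 + (|x| + |x - 1|)⁻¹ * |x - (k : ℝ)| := by
  rw [normalizedAbs_coe, zero_add, div_eq_inv_mul]

lemma tendsto_abs_sub_div_cocompact (k : ℝ) :
    Tendsto (fun x : ℝ => |x - k| / (|x| + |x - 1|)) (cocompact ℝ) (𝓝 (1 / 2)) := by
  have hden : Tendsto (fun x : ℝ => |x| + |x - 1|) (cocompact ℝ) atTop :=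
    tendsto_atTop_mono (fun x => le_add_of_nonneg_right (abs_nonneg (x - 1)))
      (tendsto_norm_cocompact_atTop (E := ℝ))
  rw [tendsto_iff_dist_tendsto_zero]
  refine squeeze_zero (fun _ => dist_nonneg) (fun x => ?_)
    (hden.const_div_atTop (|k| + 1))
  have hpos := abs_add_abs_sub_one_pos x
  have h : |x - k| / (|x| + |x - 1|) - 1 / 2 =
      (|x - k| - (|x| + |x - 1|) / 2) / (|x| + |x - 1|) := by
    field_simp
  rw [Real.dist_eq, h, abs_div, abs_of_pos hpos]
  gcongr
  have h₁ := abs_le.1 (abs_abs_sub_abs_le_abs_sub (x - k) x)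
  have h₂ := abs_le.1 (abs_abs_sub_abs_le_abs_sub (x - 1) x)
  rw [sub_sub_cancel_left, abs_neg] at h₁ h₂
  rw [abs_one] at h₂
  rw [abs_le]
  constructor <;> linarith [abs_nonneg k]

lemma continuous_normalizedAbs : Continuous normalizedAbs := by
  refine continuous_pi fun k => ?_
  rw [OnePoint.continuous_iff, coclosedCompact_eq_cocompact]
  refine ⟨tendsto_abs_sub_div_cocompact k, ?_⟩
  exact Continuous.div (by fun_prop) (by fun_prop) fun x => (abs_add_abs_sub_one_pos x).ne'

lemma normalizedAbs_injective : Function.Injective normalizedAbs := by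
  have hne (x : ℝ) : normalizedAbs x ≠ normalizedAbs OnePoint.infty := fun h => by
    have hx := inv_ne_zero (abs_add_abs_sub_one_pos x).ne'
    refine hx (add_mul_abs_sub_intCast_unique (x := x) (w := 0) (x' := 0) (v' := 0) (w' := 1 / 2) hx
      fun k => ?_).2.1
    rw [← normalizedAbs_coe_eq, h, normalizedAbs_infty, zero_mul, add_zero]
  intro p q h
  induction p using OnePoint.rec with
  | infty =>
    induction q using OnePoint.rec with
    | infty => rfl
    | coe y => exact absurd h.symm (hne y)
  | coe x =>
    induction q using OnePoint.rec with
    | infty => exact absurd h (hne x)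
    | coe y =>
      congr 1
      refine (add_mul_abs_sub_intCast_unique (w := 0) (v' := (|y| + |y - 1|)⁻¹) (w' := 0)
        (inv_ne_zero (abs_add_abs_sub_one_pos x).ne') fun k => ?_).1
      rw [← normalizedAbs_coe_eq, h, normalizedAbs_coe_eq]

lemma range_normalizedAbs : Set.range normalizedAbs = K \ D := by
  ext f
  constructor
  · rintro ⟨p, rfl⟩
    induction p using OnePoint.rec with
    | infty =>
      refine ⟨⟨⟨0, 0, 1 / 2, le_rfl, by norm_num, by simp⟩, by norm_num⟩, ?_⟩
      rintro ⟨⟨x, v, w, hv, -, h⟩, -⟩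
      refine hv.ne' (add_mul_abs_sub_intCast_unique (x := x) (w := w) (x' := 0) (v' := 0)
        (w' := 1 / 2) hv.ne' fun k => ?_).2.1
      rw [← h, normalizedAbs_infty, zero_mul, add_zero]
    | coe x =>
      have hpos := abs_add_abs_sub_one_pos x
      refine ⟨⟨⟨x, _, 0, (inv_pos.2 hpos).le, le_rfl, normalizedAbs_coe_eq x⟩, ?_⟩, ?_⟩
      · rw [normalizedAbs_coe, normalizedAbs_coe, ← add_div]
        simpa using div_self hpos.ne'
      · rintro ⟨⟨y, v, w, hv, hw, h⟩, -⟩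
        refine hw.ne' (add_mul_abs_sub_intCast_unique (x := y) (x' := x)
          (v' := (|x| + |x - 1|)⁻¹) hv.ne' fun k => ?_).2.2
        rw [← h, normalizedAbs_coe_eq]
  · rintro ⟨⟨⟨x, v, w, hv, hw, h⟩, hsum⟩, hD⟩
    have hsum' := hsum
    rw [h, h, Int.cast_zero, Int.cast_one, sub_zero] at hsum'
    rcases hv.eq_or_lt with rfl | hv
    · refine ⟨OnePoint.infty, funext fun k => ?_⟩
      rw [h, normalizedAbs_infty]
      linarith
    · rcases hw.eq_or_lt with rfl | hw
      · refine ⟨x, funext fun k => ?_⟩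
        have hv' : v = (|x| + |x - 1|)⁻¹ := eq_inv_of_mul_eq_one_left (by linarith)
        rw [h, normalizedAbs_coe_eq, hv']
      · exact absurd ⟨⟨x, v, w, hv, hw, h⟩, hsum⟩ hD

/-- `K \ D`, with the subspace topology induced from the product topology on
`ℤ → ℝ`, is homeomorphic to the unit circle in the Euclidean plane. -/
theorem stmt_4 : Nonempty (↥(K \ D) ≃ₜ {p : EuclideanSpace ℝ (Fin 2) // ‖p‖ = 1}) := by
  have e₁ : OnePoint ℝ ≃ₜ ↥(K \ D) :=
    (continuous_normalizedAbs.isClosedEmbedding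
      normalizedAbs_injective).isEmbedding.toHomeomorph.trans (.setCongr range_normalizedAbs)
  have e₂ : ℝ ≃ₜ EuclideanSpace ℝ (Fin 1) :=
    (Homeomorph.funUnique (Fin 1) ℝ).symm.trans
      (EuclideanSpace.equiv (Fin 1) ℝ).toHomeomorph.symm
  have e₃ : OnePoint (EuclideanSpace ℝ (Fin 1)) ≃ₜ
      Metric.sphere (0 : EuclideanSpace ℝ (Fin 2)) 1 :=
    onePointEquivSphereOfFinrankEq (by simp)
  exact ⟨e₁.symm.trans <| e₂.onePointCongr.trans <| e₃.trans <|
    (Homeomorph.refl _).subtype fun _ => mem_sphere_zero_iff_norm⟩
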